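/- Let α ∈ Δ and σ, τ ∈ 𝓘 with σ < τ in the Bruhat order. If s_α ∘ σ > σ and s_α ∘ τ < τ, then s_α ∘ σ ≤ τ and σ ≤ s_α ∘ τ (lifting property for involutions). -/

import Mathlib

open scoped RealInnerProductSpace
open Classical

noncomputable section

variable (V : Type) [NormedAddCommGroup V] [InnerProductSpace ℝ V]

/-- The reflection determined by a vector `α` (the identity map if `α = 0`),
as a linear endomorphism:  `x ↦ x - (2⟪x,α⟫/⟪α,α⟫) • α`. -/
def reflMap (α : V) : V →ₗ[ℝ] V where
  toFun x := x - (2 * ⟪x, α⟫ / ⟪α, α⟫) • α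
  map_add' x y := by
    simp only [inner_add_left]
    rw [show 2 * (⟪x, α⟫ + ⟪y, α⟫) / ⟪α, α⟫
        = 2 * ⟪x, α⟫ / ⟪α, α⟫ + 2 * ⟪y, α⟫ / ⟪α, α⟫ by ring, add_smul]
    abel
  map_smul' c x := by
    simp only [real_inner_smul_left, RingHom.id_apply, smul_sub]
    rw [show 2 * (c * ⟪x, α⟫) / ⟪α, α⟫ = c * (2 * ⟪x, α⟫ / ⟪α, α⟫) by ring,
      mul_smul]

lemma reflMap_apply (α x : V) :
    reflMap V α x = x - (2 * ⟪x, α⟫ / ⟪α, α⟫) • α := rfl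

lemma reflMap_involutive (α : V) : ∀ x, reflMap V α (reflMap V α x) = x := by
  intro x
  by_cases h : (⟪α, α⟫ : ℝ) = 0
  · have h0 : α = 0 := inner_self_eq_zero.mp h
    simp [reflMap_apply, h0]
  · rw [reflMap_apply, reflMap_apply, inner_sub_left, real_inner_smul_left,
      div_mul_cancel₀ _ h]
    rw [show ⟪x, α⟫ - 2 * ⟪x, α⟫ = -⟪x, α⟫ by ring]
    rw [show 2 * -⟪x, α⟫ / ⟪α, α⟫ = -(2 * ⟪x, α⟫ / ⟪α, α⟫) by ring, neg_smul]
    abel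

/-- The reflection determined by a vector `α`, as a linear automorphism of `V`. -/
def sref (α : V) : V ≃ₗ[ℝ] V :=
  { reflMap V α with
    invFun := reflMap V α
    left_inv := reflMap_involutive V α
    right_inv := reflMap_involutive V α }

lemma sref_apply (α x : V) :
    sref V α x = x - (2 * ⟪x, α⟫ / ⟪α, α⟫) • α := rfl

variable {V}

/-- The coroot `α^∨ = 2α/⟪α,α⟫` associated with a root `α`, under the identification of the
coweight space with `V` given by the inner product. -/
def coroot (α : V) : V := (2 / ⟪α, α⟫) • α

/-- The dimension of the `(-1)`-eigenspace of a linear automorphism. -/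
def lamEig (σ : V ≃ₗ[ℝ] V) : ℕ :=
  Module.finrank ℝ (Module.End.eigenspace (σ : V →ₗ[ℝ] V) (-1))

/-- The action `s_α ∘ σ` of a simple reflection on an involution: `s_α σ` if `s_α` and `σ`
commute, and `s_α σ s_α` otherwise. -/
def circAct (α : V) (σ : V ≃ₗ[ℝ] V) : V ≃ₗ[ℝ] V :=
  if sref V α * σ = σ * sref V α then sref V α * σ else sref V α * σ * sref V α

/-- A set of pairwise orthogonal vectors. -/
def OrthSet (S : Finset V) : Prop :=
  (↑S : Set V).Pairwise fun a b => ⟪a, b⟫ = 0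

/-- The product `σ_S` of the (commuting) reflections in the elements of an orthogonal set
`S`. -/
def sigmaOf (S : Finset V) : V ≃ₗ[ℝ] V :=
  (S.toList.map (sref V)).prod

variable (V)

/-- A finite crystallographic reduced root system in the Euclidean space `V`,
together with a fixed choice of simple roots. -/
structure RSD where
  /-- The set of roots. -/
  Φ : Finset V
  /-- The set of simple roots. -/
  Δ : Finset V
  nonzero : (0 : V) ∉ Φ
  span_top : Submodule.span ℝ (Φ : Set V) = ⊤
  reduced : ∀ α ∈ Φ, ∀ c : ℝ, c • α ∈ Φ → c = 1 ∨ c = -1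
  crystal : ∀ α ∈ Φ, ∀ β ∈ Φ, ∃ n : ℤ, (n : ℝ) = 2 * ⟪β, α⟫ / ⟪α, α⟫
  reflClosed : ∀ α ∈ Φ, ∀ β ∈ Φ, sref V α β ∈ Φ
  Δ_sub : Δ ⊆ Φ
  Δ_indep : LinearIndependent ℝ (fun x : (Δ : Set V) => (x : V))
  Δ_base : ∀ α ∈ Φ, (∃ c : V → ℕ, α = ∑ γ ∈ Δ, (c γ : ℝ) • γ) ∨
      (∃ c : V → ℕ, -α = ∑ γ ∈ Δ, (c γ : ℝ) • γ)

namespace RSD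

variable {V}
variable (D : RSD V)

/-- The set of positive roots. -/
def Pos : Set V :=
  {α | α ∈ D.Φ ∧ ∃ c : V → ℕ, α = ∑ γ ∈ D.Δ, (c γ : ℝ) • γ}

/-- The set of negative roots. -/
def Neg : Set V := {α | -α ∈ D.Pos}

/-- The Weyl group, as the subgroup of `GL(V)` generated by the simple reflections. -/
def W : Subgroup (V ≃ₗ[ℝ] V) := Subgroup.closure ((fun γ => sref V γ) '' ↑D.Δ)

/-- The length of `w`: the least number of simple reflections needed to write `w` as a
product of simple reflections. -/
def length (w : V ≃ₗ[ℝ] V) : ℕ :=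
  sInf {n | ∃ l : List V, l.length = n ∧ (∀ γ ∈ l, γ ∈ D.Δ) ∧ w = (l.map (sref V)).prod}

/-- The Bruhat order on the Weyl group: `u ≤ v` iff `v` is obtained from `u` by successively
multiplying by reflections, each time increasing the length. -/
def ble (u v : V ≃ₗ[ℝ] V) : Prop :=
  Relation.ReflTransGen
    (fun x y => (∃ β ∈ D.Φ, y = sref V β * x) ∧ D.length x < D.length y) u v

/-- The strict Bruhat order. -/
def blt (u v : V ≃ₗ[ℝ] V) : Prop := D.ble u v ∧ u ≠ v

/-- The dominance order: `y - x` is a nonnegative integer combination of simple roots. -/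
def dom (x y : V) : Prop := ∃ c : V → ℕ, y - x = ∑ γ ∈ D.Δ, (c γ : ℝ) • γ

/-- The dominance order on coweights: `y - x` is a nonnegative integer combination of simple
coroots. -/
def cdom (x y : V) : Prop := ∃ c : V → ℕ, y - x = ∑ γ ∈ D.Δ, (c γ : ℝ) • coroot γ

/-- The length `L(σ) = (ℓ(σ) + λ(σ))/2` of an involution `σ`, where `λ(σ)` is the dimension
of the `(-1)`-eigenspace of `σ`. -/
def Linv (σ : V ≃ₗ[ℝ] V) : ℚ :=
  ((D.length σ : ℚ) + (lamEig σ : ℚ)) / 2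

end RSD

/-- A finite irreducible crystallographic reduced root system, with a fixed choice of simple
roots and a marked simple root `αP` whose coefficient in the highest root `θ` equals `1`
(the cominuscule case). -/
structure MRSD extends RSD V where
  irred : ¬ ∃ A B : Set V, A.Nonempty ∧ B.Nonempty ∧ A ∪ B = ↑Φ ∧
      ∀ α ∈ A, ∀ β ∈ B, ⟪α, β⟫ = 0
  /-- The marked simple root. -/
  αP : V
  αP_mem : αP ∈ Δ
  /-- The highest root. -/
  θ : V
  θ_mem : θ ∈ Φ
  θ_high : ∀ α ∈ Φ, ∃ c : V → ℕ, θ - α = ∑ γ ∈ Δ, (c γ : ℝ) • γ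
  θ_coeff : ∃ c : V → ℕ, (θ = ∑ γ ∈ Δ, (c γ : ℝ) • γ) ∧ c αP = 1

namespace MRSD

variable {V}
variable (M : MRSD V)

/-- The set `Ψ` of positive roots in which the marked simple root `αP` has coefficient `1`. -/
def Psi : Set V :=
  {α | α ∈ M.Φ ∧ ∃ c : V → ℕ, (α = ∑ γ ∈ M.Δ, (c γ : ℝ) • γ) ∧ c M.αP = 1}

/-- The set of positive roots of the subsystem `Φ_P`, i.e. the positive roots in which the
marked simple root `αP` has coefficient `0`. -/
def PosP : Set V :=
  {α | α ∈ M.Φ ∧ ∃ c : V → ℕ, (α = ∑ γ ∈ M.Δ, (c γ : ℝ) • γ) ∧ c M.αP = 0}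

/-- The parabolic subgroup `W_P` generated by the simple reflections in `Δ ∖ {αP}`. -/
def WP : Subgroup (V ≃ₗ[ℝ] V) :=
  Subgroup.closure ((fun γ => sref V γ) '' ↑(M.Δ.erase M.αP))

/-- The inversion set `Φ⁺(v) = {α ∈ Φ⁺ : v(α) ∈ Φ⁻}`. -/
def InvSet (v : V ≃ₗ[ℝ] V) : Set V := {α | α ∈ M.Pos ∧ v α ∈ M.Neg}

/-- `v` belongs to `W^P`: it lies in `W` and has minimal length in its coset `v W_P`. -/
def IsMinRep (v : V ≃ₗ[ℝ] V) : Prop :=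
  v ∈ M.W ∧ ∀ u, u ∈ M.W → v⁻¹ * u ∈ M.WP → M.length v ≤ M.length u

/-- `μ` is the minimal length representative `[w]^P` of the coset `w W_P`. -/
def IsMinRepOf (μ w : V ≃ₗ[ℝ] V) : Prop :=
  (μ ∈ M.W ∧ w⁻¹ * μ ∈ M.WP) ∧
    ∀ u, u ∈ M.W → w⁻¹ * u ∈ M.WP → M.length μ ≤ M.length u

/-- The subset `Φ_S = {α ∈ Φ : σ_S(α) = -α}` determined by an orthogonal set of roots `S`. -/
def PhiSet (S : Finset V) : Set V := {α | α ∈ M.Φ ∧ sigmaOf S α = -α}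

/-- A root is long if its squared length is maximal among the roots. -/
def IsLong (α : V) : Prop := ∀ β ∈ M.Φ, ⟪β, β⟫ ≤ ⟪α, α⟫

/-- Admissible pair: `v ∈ W^P`, `S ⊆ Ψ` a set of pairwise orthogonal roots with
`v(S) ⊆ Φ⁻`. -/
def Admissible (v : V ≃ₗ[ℝ] V) (S : Finset V) : Prop :=
  M.IsMinRep v ∧ (↑S : Set V) ⊆ M.Psi ∧ OrthSet S ∧ ∀ β ∈ S, v β ∈ M.Neg

/-- The length `L(v,S) = (ℓ(σ_{v(S)}) + |S|)/2` of an admissible pair `(v,S)`. -/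
def pairL (v : V ≃ₗ[ℝ] V) (S : Finset V) : ℚ :=
  ((M.length (sigmaOf (S.image fun x => v x)) : ℚ) + (S.card : ℚ)) / 2

end MRSD

namespace RSD

variable {V}

lemma sref_mul_self (α : V) : sref V α * sref V α = 1 :=
  LinearEquiv.ext (reflMap_involutive V α)

lemma sref_inv (α : V) : (sref V α)⁻¹ = sref V α :=
  inv_eq_of_mul_eq_one_left (sref_mul_self α)

lemma sref_neg (α : V) : sref V (-α) = sref V α := by
  ext x
  simp [sref_apply, neg_div]

lemma sref_self (α : V) : sref V α α = -α := by
  rcases eq_or_ne α 0 with rfl | h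
  · simp
  · have : (⟪α, α⟫ : ℝ) ≠ 0 := inner_self_ne_zero.mpr h
    rw [sref_apply, mul_div_cancel_right₀ _ this, two_smul]
    abel

lemma inner_sref_sref (α x y : V) : ⟪sref V α x, sref V α y⟫ = ⟪x, y⟫ := by
  rcases eq_or_ne α 0 with rfl | h
  · simp [sref_apply]
  · have : (⟪α, α⟫ : ℝ) ≠ 0 := inner_self_ne_zero.mpr h
    simp only [sref_apply, inner_sub_left, inner_sub_right, real_inner_smul_left,
      real_inner_smul_right, real_inner_comm α]
    field_simp
    ring

lemma sref_conj {w : V ≃ₗ[ℝ] V} (hw : ∀ x y, ⟪w x, w y⟫ = ⟪x, y⟫) (β : V) :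
    sref V (w β) * w = w * sref V β := by
  ext x
  simp only [LinearEquiv.mul_apply, sref_apply, hw, map_sub, map_smul]

variable (D : RSD V)

variable {D} in
lemma sref_mem_W {γ : V} (hγ : γ ∈ D.Δ) : sref V γ ∈ D.W :=
  Subgroup.subset_closure ⟨γ, hγ, rfl⟩

variable {D} in
lemma inner_map_map {w : V ≃ₗ[ℝ] V} (hw : w ∈ D.W) : ∀ x y, ⟪w x, w y⟫ = ⟪x, y⟫ := by
  induction hw using Subgroup.closure_induction with
  | mem w h => obtain ⟨γ, -, rfl⟩ := h; exact inner_sref_sref γ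
  | one => simp
  | mul a b _ _ ha hb => intro x y; simp [ha, hb]
  | inv a _ ha =>
    intro x y
    rw [← ha, ← LinearEquiv.mul_apply, ← LinearEquiv.mul_apply, mul_inv_cancel]
    rfl

variable {D} in
lemma map_mem_roots_iff {w : V ≃ₗ[ℝ] V} (hw : w ∈ D.W) : ∀ {β}, w β ∈ D.Φ ↔ β ∈ D.Φ := by
  induction hw using Subgroup.closure_induction with
  | mem w h =>
    obtain ⟨γ, hγ, rfl⟩ := h
    have hΦ := D.reflClosed γ (D.Δ_sub hγ)
    exact fun {β} => ⟨fun h => reflMap_involutive V γ β ▸ hΦ _ h, hΦ β⟩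
  | one => simp
  | mul a b _ _ ha hb => intro β; rw [LinearEquiv.mul_apply, ha, hb]
  | inv a _ ha =>
    intro β
    rw [← ha, ← LinearEquiv.mul_apply, mul_inv_cancel]
    rfl

variable {D} in
lemma pos_or_neg {β : V} (hβ : β ∈ D.Φ) : β ∈ D.Pos ∨ -β ∈ D.Pos := by
  refine (D.Δ_base β hβ).imp (fun h => ⟨hβ, h⟩) fun h => ⟨?_, h⟩
  rw [← sref_self]
  exact D.reflClosed β hβ β hβ

variable {D} in
lemma simple_mem_Pos {γ : V} (hγ : γ ∈ D.Δ) : γ ∈ D.Pos :=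
  ⟨D.Δ_sub hγ, fun δ => if δ = γ then 1 else 0, by simp [hγ]⟩

lemma coeff_eq_zero {c : V → ℝ} (h : ∑ γ ∈ D.Δ, c γ • γ = 0) {γ : V} (hγ : γ ∈ D.Δ) :
    c γ = 0 :=
  (linearIndepOn_finset_iff (v := id)).mp D.Δ_indep c h γ hγ

variable {D} in
/-- A simple reflection permutes the positive roots other than its own simple root. -/
lemma sref_mem_Pos {γ β : V} (hγ : γ ∈ D.Δ) (hβ : β ∈ D.Pos) (hne : β ≠ γ) :
    sref V γ β ∈ D.Pos := by
  obtain ⟨hβΦ, c, hc⟩ := hβ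
  refine (pos_or_neg (D.reflClosed γ (D.Δ_sub hγ) β hβΦ)).resolve_right ?_
  rintro ⟨-, d, hd⟩
  have hγsum (k : ℝ) : k • γ = ∑ δ ∈ D.Δ, (if δ = γ then k else 0) • δ := by simp [ite_smul, hγ]
  have hzero : ∀ δ ∈ D.Δ, δ ≠ γ → c δ = 0 := by
    intro δ hδ hδγ
    set k := 2 * ⟪β, γ⟫ / ⟪γ, γ⟫ with hk
    have h0 : ∑ δ ∈ D.Δ, ((c δ : ℝ) + d δ - if δ = γ then k else 0) • δ = 0 := by
      simp only [sub_smul, add_smul, Finset.sum_add_distrib, Finset.sum_sub_distrib]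
      rw [← hγsum, ← hc, ← hd, sref_apply, ← hk]
      abel
    have := D.coeff_eq_zero h0 hδ
    rw [if_neg hδγ, sub_zero] at this
    have : c δ + d δ = 0 := by exact_mod_cast this
    omega
  have hβ' : β = (c γ : ℝ) • γ := by
    rw [hc]
    refine Finset.sum_eq_single_of_mem γ hγ fun δ hδ hδγ => ?_
    simp [hzero δ hδ hδγ]
  rcases D.reduced γ (D.Δ_sub hγ) (c γ) (hβ' ▸ hβΦ) with h | h
  · exact hne (by rw [hβ', h, one_smul])
  · have : (0 : ℝ) ≤ c γ := Nat.cast_nonneg _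
    linarith

lemma exists_word {w : V ≃ₗ[ℝ] V} (hw : w ∈ D.W) :
    ∃ l : List V, l.length = D.length w ∧ (∀ γ ∈ l, γ ∈ D.Δ) ∧ w = (l.map (sref V)).prod := by
  refine Nat.sInf_mem (s := {n | ∃ l : List V, l.length = n ∧ (∀ γ ∈ l, γ ∈ D.Δ) ∧
    w = (l.map (sref V)).prod}) ?_
  induction hw using Subgroup.closure_induction with
  | mem w h => obtain ⟨γ, hγ, rfl⟩ := h; exact ⟨1, [γ], rfl, by simpa using hγ, by simp⟩
  | one => exact ⟨0, [], rfl, by simp, rfl⟩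
  | mul a b _ _ ha hb =>
    obtain ⟨-, l, -, hl, rfl⟩ := ha
    obtain ⟨-, m, -, hm, rfl⟩ := hb
    refine ⟨_, l ++ m, rfl, ?_, by simp⟩
    simpa [or_imp, forall_and] using And.intro hl hm
  | inv a _ ha =>
    obtain ⟨-, l, -, hl, rfl⟩ := ha
    refine ⟨_, l.reverse, rfl, by simpa using hl, ?_⟩
    rw [List.prod_inv_reverse, List.map_map, List.map_reverse]
    simp [Function.comp_def, sref_inv]

variable {D} in
lemma length_prod_le {l : List V} (hl : ∀ γ ∈ l, γ ∈ D.Δ) :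
    D.length (l.map (sref V)).prod ≤ l.length :=
  Nat.sInf_le ⟨l, rfl, hl, rfl⟩

variable {D} in
lemma mem_W_of_length_pos {w : V ≃ₗ[ℝ] V} (h : 0 < D.length w) : w ∈ D.W := by
  obtain ⟨-, l, -, hl, rfl⟩ := Nat.nonempty_of_pos_sInf h
  refine Subgroup.list_prod_mem _ fun x hx => ?_
  obtain ⟨γ, hγ, rfl⟩ := List.mem_map.mp hx
  exact sref_mem_W (hl γ hγ)

variable {D} in
lemma length_inv_le {w : V ≃ₗ[ℝ] V} (hw : w ∈ D.W) : D.length w⁻¹ ≤ D.length w := by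
  obtain ⟨l, hlen, hl, hprod⟩ := D.exists_word hw
  have h : w⁻¹ = (l.reverse.map (sref V)).prod := by
    rw [hprod, List.prod_inv_reverse, List.map_map, List.map_reverse]
    simp [Function.comp_def, sref_inv]
  rw [h, ← hlen, ← List.length_reverse]
  exact length_prod_le (by simpa using hl)

variable {D} in
lemma length_inv {w : V ≃ₗ[ℝ] V} (hw : w ∈ D.W) : D.length w⁻¹ = D.length w :=
  (length_inv_le hw).antisymm (by simpa using length_inv_le (inv_mem hw))

variable {D} in
lemma length_sref_mul_le {γ : V} (hγ : γ ∈ D.Δ) {w : V ≃ₗ[ℝ] V} (hw : w ∈ D.W) :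
    D.length (sref V γ * w) ≤ D.length w + 1 := by
  obtain ⟨l, hlen, hl, hprod⟩ := D.exists_word hw
  have h : sref V γ * w = ((γ :: l).map (sref V)).prod := by simp [hprod]
  rw [h, ← hlen, ← List.length_cons (a := γ)]
  exact length_prod_le (by simpa [hγ] using hl)

variable {D} in
/-- The strong exchange property for words in the simple reflections. -/
lemma exists_word_deletion {l : List V} (hl : ∀ γ ∈ l, γ ∈ D.Δ) {β : V} (hβ : β ∈ D.Pos)
    (hneg : (l.map (sref V)).prod⁻¹ β ∉ D.Pos) :
    ∃ m : List V, m.length + 1 = l.length ∧ (∀ γ ∈ m, γ ∈ D.Δ) ∧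
      sref V β * (l.map (sref V)).prod = (m.map (sref V)).prod := by
  induction l generalizing β with
  | nil => exact absurd hβ (by simpa using hneg)
  | cons γ l ih =>
    have hγ : γ ∈ D.Δ := hl γ (by simp)
    have hl' : ∀ δ ∈ l, δ ∈ D.Δ := fun δ hδ => hl δ (by simp [hδ])
    simp only [List.map_cons, List.prod_cons] at hneg ⊢
    rcases eq_or_ne β γ with rfl | hne
    · exact ⟨l, rfl, hl', by rw [← mul_assoc, sref_mul_self, one_mul]⟩
    · rw [mul_inv_rev, sref_inv, LinearEquiv.mul_apply] at hneg
      obtain ⟨m, hm, hmΔ, h⟩ := ih hl' (sref_mem_Pos hγ hβ hne) hneg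
      refine ⟨γ :: m, by simp [hm], by simpa [hγ] using hmΔ, ?_⟩
      rw [List.map_cons, List.prod_cons, ← h, ← mul_assoc, ← mul_assoc,
        ← sref_conj (inner_sref_sref γ) (sref V γ β), ← LinearEquiv.mul_apply (sref V γ),
        sref_mul_self]
      rfl

variable {D} in
lemma length_sref_mul_lt {w : V ≃ₗ[ℝ] V} (hw : w ∈ D.W) {β : V} (hβ : β ∈ D.Pos)
    (hneg : w⁻¹ β ∉ D.Pos) : D.length (sref V β * w) < D.length w := by
  obtain ⟨l, hlen, hl, rfl⟩ := D.exists_word hw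
  obtain ⟨m, hm, hmΔ, h⟩ := exists_word_deletion hl hβ hneg
  rw [h, ← hlen, ← hm]
  exact Nat.lt_succ_of_le (length_prod_le hmΔ)

variable {D} in
lemma neg_notMem_Pos {β : V} (hβ : β ∈ D.Pos) : -β ∉ D.Pos := by
  rintro ⟨-, d, hd⟩
  obtain ⟨hβΦ, c, hc⟩ := hβ
  have h0 : ∑ δ ∈ D.Δ, ((c δ : ℝ) + d δ) • δ = 0 := by
    simp only [add_smul, Finset.sum_add_distrib]
    rw [← hc, ← hd, add_neg_cancel]
  have hzero : ∀ δ ∈ D.Δ, c δ = 0 := by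
    intro δ hδ
    have : c δ + d δ = 0 := by exact_mod_cast D.coeff_eq_zero h0 hδ
    omega
  refine D.nonzero ?_
  rwa [hc, Finset.sum_eq_zero fun δ hδ => by simp [hzero δ hδ]] at hβΦ

variable {D} in
lemma lt_length_sref_mul {w : V ≃ₗ[ℝ] V} {β : V} (hw : sref V β * w ∈ D.W)
    (hβ : β ∈ D.Pos) (hpos : w⁻¹ β ∈ D.Pos) : D.length w < D.length (sref V β * w) := by
  have h := length_sref_mul_lt hw hβ (by
    rw [mul_inv_rev, sref_inv, LinearEquiv.mul_apply, sref_self, map_neg]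
    exact neg_notMem_Pos hpos)
  rwa [← mul_assoc, sref_mul_self, one_mul] at h

variable {D} in
lemma length_sref_mul_lt_or {α : V} (hα : α ∈ D.Δ) {w : V ≃ₗ[ℝ] V} (hw : w ∈ D.W) :
    D.length (sref V α * w) < D.length w ∨ D.length w < D.length (sref V α * w) := by
  by_cases h : w⁻¹ α ∈ D.Pos
  · exact .inr (lt_length_sref_mul (mul_mem (sref_mem_W hα) hw) (simple_mem_Pos hα) h)
  · exact .inl (length_sref_mul_lt hw (simple_mem_Pos hα) h)

/-- A single step in the definition of the Bruhat order. -/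
def Step (x y : V ≃ₗ[ℝ] V) : Prop :=
  (∃ β ∈ D.Φ, y = sref V β * x) ∧ D.length x < D.length y

variable {D} {x y u v : V ≃ₗ[ℝ] V}

lemma Step.ble (h : D.Step x y) : D.ble x y := .single h

lemma Step.mem_W (h : D.Step x y) : y ∈ D.W :=
  mem_W_of_length_pos (Nat.zero_lt_of_lt h.2)

lemma step_sref_mul {α : V} (hα : α ∈ D.Δ) (h : D.length x < D.length (sref V α * x)) :
    D.Step x (sref V α * x) :=
  ⟨⟨α, D.Δ_sub hα, rfl⟩, h⟩

lemma step_of_sref_mul {α : V} (hα : α ∈ D.Δ) (h : D.length (sref V α * x) < D.length x) :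
    D.Step (sref V α * x) x :=
  ⟨⟨α, D.Δ_sub hα, by rw [← mul_assoc, sref_mul_self, one_mul]⟩, h⟩

lemma Step.inv (hx : x ∈ D.W) (h : D.Step x y) : D.Step x⁻¹ y⁻¹ := by
  have hy := h.mem_W
  obtain ⟨⟨β, hβ, rfl⟩, hlt⟩ := h
  refine ⟨⟨x⁻¹ β, (map_mem_roots_iff (inv_mem hx)).mpr hβ, ?_⟩, ?_⟩
  · rw [sref_conj (inner_map_map (inv_mem hx)), mul_inv_rev, sref_inv]
  · rwa [length_inv hx, length_inv hy]

lemma ble_mem_W (hu : u ∈ D.W) (h : D.ble u v) : v ∈ D.W := by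
  induction h with
  | refl => exact hu
  | tail _ h _ => exact Step.mem_W h

lemma ble_inv (hu : u ∈ D.W) (h : D.ble u v) : D.ble u⁻¹ v⁻¹ := by
  induction h with
  | refl => exact .refl
  | tail huy h ih => exact ih.tail (Step.inv (ble_mem_W hu huy) h)

lemma blt.length_lt (h : D.blt u v) : D.length u < D.length v := by
  have hle (w) (hw : D.ble u w) : D.length u ≤ D.length w := by
    induction hw with
    | refl => exact le_rfl
    | tail _ h ih => exact ih.trans h.2.le
  rcases Relation.ReflTransGen.cases_tail h.1 with heq | ⟨w, huw, hwv⟩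
  · exact absurd heq.symm h.2
  · exact (hle w huw).trans_lt hwv.2

/-- Left multiplication by a simple reflection preserves every Bruhat step, except the one given
by the same reflection. -/
lemma Step.eq_or_sref_mul {α : V} (hα : α ∈ D.Δ) (hx : x ∈ D.W) (h : D.Step x y) :
    y = sref V α * x ∨ D.Step (sref V α * x) (sref V α * y) := by
  have hy := h.mem_W
  obtain ⟨⟨β, hβ, rfl⟩, hlt⟩ := h
  wlog hpos : β ∈ D.Pos generalizing β
  · have hneg := (pos_or_neg hβ).resolve_left hpos
    simpa [sref_neg] using this (-β) hneg.1 (by rwa [sref_neg]) (by rwa [sref_neg]) hneg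
  rcases eq_or_ne β α with rfl | hne
  · exact .inl rfl
  right
  have hxβ : x⁻¹ β ∈ D.Pos := by
    by_contra hneg
    exact absurd (length_sref_mul_lt hx hpos hneg) hlt.not_gt
  have hconj : sref V α * (sref V β * x) = sref V (sref V α β) * (sref V α * x) := by
    rw [← mul_assoc, ← mul_assoc, sref_conj (inner_sref_sref α)]
  refine ⟨⟨_, D.reflClosed α (D.Δ_sub hα) β hβ, hconj⟩, ?_⟩
  have hW : sref V α * (sref V β * x) ∈ D.W := mul_mem (sref_mem_W hα) hy
  rw [hconj] at hW ⊢
  refine lt_length_sref_mul hW (sref_mem_Pos hα hpos hne) ?_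
  rw [mul_inv_rev, sref_inv, LinearEquiv.mul_apply, ← LinearEquiv.mul_apply (sref V α),
    sref_mul_self]
  exact hxβ

lemma sref_mul_ble_or {α : V} (hα : α ∈ D.Δ) (hu : u ∈ D.W) (h : D.ble u v) :
    D.ble (sref V α * u) v ∨ D.ble (sref V α * u) (sref V α * v) := by
  induction h with
  | refl => exact .inr .refl
  | tail huy h ih =>
    rcases ih with ih | ih
    · exact .inl (ih.tail h)
    · rcases Step.eq_or_sref_mul hα (ble_mem_W hu huy) h with rfl | h'
      · exact .inl ih
      · exact .inr (ih.tail h')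

lemma ble_sref_mul_or {α : V} (hα : α ∈ D.Δ) (hu : u ∈ D.W) (h : D.ble u v) :
    D.ble u (sref V α * v) ∨ D.ble (sref V α * u) (sref V α * v) := by
  induction h with
  | refl => exact .inr .refl
  | tail huy h ih =>
    rcases Step.eq_or_sref_mul hα (ble_mem_W hu huy) h with rfl | h'
    · rw [← mul_assoc, sref_mul_self, one_mul]
      exact .inl huy
    · exact ih.imp (.tail · h') (.tail · h')

/-- If `v` has `s_α` as a left descent and `u ≤ v`, then `s_α u ≤ v`. -/
lemma sref_mul_ble {α : V} (hα : α ∈ D.Δ) (hu : u ∈ D.W) (h : D.ble u v)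
    (hv : D.length (sref V α * v) < D.length v) : D.ble (sref V α * u) v :=
  (sref_mul_ble_or hα hu h).elim id fun h' => h'.trans (step_of_sref_mul hα hv).ble

/-- If `s_α` is not a left descent of `u` and `u ≤ v`, then `u ≤ s_α v`. -/
lemma ble_sref_mul {α : V} (hα : α ∈ D.Δ) (hu : u ∈ D.W) (h : D.ble u v)
    (hu' : D.length u < D.length (sref V α * u)) : D.ble u (sref V α * v) :=
  (ble_sref_mul_or hα hu h).elim id fun h' => (step_sref_mul hα hu').ble.trans h'

lemma length_mul_sref {α : V} (hα : α ∈ D.Δ) {σ : V ≃ₗ[ℝ] V} (hσW : σ ∈ D.W)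
    (hσ : σ * σ = 1) : D.length (σ * sref V α) = D.length (sref V α * σ) := by
  rw [← length_inv (mul_mem (sref_mem_W hα) hσW), mul_inv_rev, sref_inv,
    inv_eq_of_mul_eq_one_left hσ]

lemma lt_length_of_blt_circAct {α : V} (hα : α ∈ D.Δ) {σ : V ≃ₗ[ℝ] V} (hσW : σ ∈ D.W)
    (hσ : σ * σ = 1) (h : D.blt σ (circAct α σ)) :
    D.length σ < D.length (sref V α * σ) := by
  have hlt := h.length_lt
  unfold circAct at hlt
  split_ifs at hlt
  · exact hlt
  · refine (length_sref_mul_lt_or hα hσW).resolve_left fun hlt' => ?_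
    have := length_sref_mul_le hα (mul_mem hσW (sref_mem_W hα))
    rw [length_mul_sref hα hσW hσ, ← mul_assoc] at this
    omega

lemma length_lt_of_circAct_blt {α : V} (hα : α ∈ D.Δ) {τ : V ≃ₗ[ℝ] V} (hτW : τ ∈ D.W)
    (hτ : τ * τ = 1) (h : D.blt (circAct α τ) τ) :
    D.length (sref V α * τ) < D.length τ := by
  have hlt := h.length_lt
  unfold circAct at hlt
  split_ifs at hlt
  · exact hlt
  · refine (length_sref_mul_lt_or hα hτW).resolve_right fun hlt' => ?_
    have hs := sref_mem_W hα
    have := length_sref_mul_le hα (mul_mem (mul_mem hs hτW) hs)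
    rw [← mul_assoc, ← mul_assoc, sref_mul_self, one_mul, length_mul_sref hα hτW hτ] at this
    omega

end RSD

/-- Let `α ∈ Δ` and `σ < τ` involutions with `s_α ∘ σ > σ` and
`s_α ∘ τ < τ`.  Then `s_α ∘ σ ≤ τ` and `σ ≤ s_α ∘ τ`. -/
theorem statement9 {V : Type} [NormedAddCommGroup V] [InnerProductSpace ℝ V]
    [FiniteDimensional ℝ V]
    (D : RSD V) (α : V) (hα : α ∈ D.Δ)
    (σ τ : V ≃ₗ[ℝ] V) (hσW : σ ∈ D.W) (hσ : σ * σ = 1)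
    (hτW : τ ∈ D.W) (hτ : τ * τ = 1) (hlt : D.blt σ τ)
    (h1 : D.blt σ (circAct α σ)) (h2 : D.blt (circAct α τ) τ) :
    D.ble (circAct α σ) τ ∧ D.ble σ (circAct α τ) := by
  have hs := RSD.sref_mem_W hα
  have hσs := RSD.lt_length_of_blt_circAct hα hσW hσ h1
  have hτs := RSD.length_lt_of_circAct_blt hα hτW hτ h2
  have hσi := inv_eq_of_mul_eq_one_left hσ
  have hτi := inv_eq_of_mul_eq_one_left hτ
  have hleft := RSD.sref_mul_ble hα hσW hlt.1 hτs
  have hright := RSD.ble_sref_mul hα hσW hlt.1 hσs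
  unfold circAct
  constructor
  · split_ifs
    · exact hleft
    · have h := RSD.ble_inv (mul_mem hs hσW) hleft
      rw [mul_inv_rev, RSD.sref_inv, hσi, hτi] at h
      rw [mul_assoc]
      exact RSD.sref_mul_ble hα (mul_mem hσW hs) h hτs
  · split_ifs
    · exact hright
    · have h := RSD.ble_inv hσW hright
      rw [mul_inv_rev, RSD.sref_inv, hσi, hτi] at h
      rw [mul_assoc]
      exact RSD.ble_sref_mul hα hσW h hσs
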